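/- Suppose N > 0 and let W_N be the 𝕜-subspace of V_N spanned by e_0, e_1, …, e_{N−1}. Then W_N is simple: if U ⊆ W_N is a 𝕜-subspace with E(U) ⊆ U, F(U) ⊆ U, K(U) ⊆ U, and U ≠ {0}, then U = W_N. -/

import Mathlib

open Finsupp

noncomputable section

/-- The ground field `𝕜 = ℂ(v)`. -/
abbrev kk : Type := RatFunc ℂ

/-- The variable `v`. -/
def v : kk := RatFunc.X

/-- `q = v²`. -/
def qv : kk := v ^ 2

/-- The quantum integer `[n] = (vⁿ − v⁻ⁿ)/(v − v⁻¹)`, for `n : ℤ`. -/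
def qint (n : ℤ) : kk := (v ^ n - v ^ (-n)) / (v - v⁻¹)

/-- The module `V_N`, a `𝕜`-vector space with basis `(e_i)_{i ∈ ℕ}`. -/
abbrev V : Type := ℕ →₀ kk

/-- The basis vector `e i`. -/
def e (i : ℕ) : V := Finsupp.single i 1

/-- `K e_i = v^{N−1−2i} e_i`. -/
def Kop (N : ℤ) : Module.End kk V :=
  Finsupp.lsum kk fun i => LinearMap.toSpanSingleton kk V
    (Finsupp.single i (v ^ (N - 1 - 2 * (i : ℤ))))

/-- `K⁻¹ e_i = v^{−(N−1−2i)} e_i`. -/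
def KopInv (N : ℤ) : Module.End kk V :=
  Finsupp.lsum kk fun i => LinearMap.toSpanSingleton kk V
    (Finsupp.single i (v ^ (-(N - 1 - 2 * (i : ℤ)))))

/-- `E e_i = ((1−q^i)/(1−q)) e_{i−1}` for `i ≥ 1`, `E e_0 = 0` (note that the
coefficient `(1−q^0)/(1−q)` vanishes, so the truncated subtraction `i - 1` is harmless). -/
def Eop : Module.End kk V :=
  Finsupp.lsum kk fun i => LinearMap.toSpanSingleton kk V
    (Finsupp.single (i - 1) ((1 - qv ^ i) / (1 - qv)))

/-- `F e_i = v^i [N−1−i] e_{i+1}`. -/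
def Fop (N : ℤ) : Module.End kk V :=
  Finsupp.lsum kk fun i => LinearMap.toSpanSingleton kk V
    (Finsupp.single (i + 1) (v ^ (i : ℕ) * qint (N - 1 - (i : ℤ))))

end
noncomputable section

/-- The subspace `W_N ⊆ V_N` spanned by `e_0, …, e_{N−1}`. -/
def W (N : ℤ) : Submodule kk V :=
  Submodule.span kk {f : V | ∃ i : ℕ, (i : ℤ) < N ∧ f = e i}

theorem v_ne_zero : v ≠ 0 := RatFunc.X_ne_zero

theorem v_pow_ne_one {n : ℕ} (hn : n ≠ 0) : v ^ n ≠ 1 := by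
  intro h
  have h' : (Polynomial.X ^ n : Polynomial ℂ) = 1 := by
    apply RatFunc.algebraMap_injective ℂ
    simpa [v] using h
  have := congrArg Polynomial.natDegree h'
  simp at this
  exact hn this

theorem qint_natCast_ne_zero {n : ℕ} (hn : n ≠ 0) : qint (n : ℤ) ≠ 0 := by
  have key {m : ℕ} (hm : m ≠ 0) : v ^ m - (v ^ m)⁻¹ ≠ 0 := fun h => by
    refine v_pow_ne_one (n := m + m) (by omega) ?_
    rw [pow_add]
    nth_rewrite 2 [sub_eq_zero.mp h]
    exact mul_inv_cancel₀ (pow_ne_zero _ v_ne_zero)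
  have h1 := key one_ne_zero
  rw [pow_one] at h1
  rw [qint, zpow_neg, zpow_natCast]
  exact div_ne_zero (key hn) h1

theorem one_sub_qv_pow_ne_zero {n : ℕ} (hn : n ≠ 0) : 1 - qv ^ n ≠ 0 := by
  rw [qv, ← pow_mul]
  exact sub_ne_zero.mpr (v_pow_ne_one (by omega)).symm

theorem Eop_apply (x : V) (j : ℕ) :
    Eop x j = (1 - qv ^ (j + 1)) / (1 - qv) * x (j + 1) := by
  induction x using Finsupp.induction_linear with
  | zero => simp
  | add x y hx hy => simp only [map_add, Finsupp.add_apply, hx, hy, mul_add]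
  | single i a =>
    rcases i with _ | i
    · simp [Eop]
    · rcases eq_or_ne i j with rfl | h
      · simp [Eop, mul_comm]
      · simp [Eop, h]

theorem Fop_e (N : ℤ) (i : ℕ) : Fop N (e i) = (v ^ i * qint (N - 1 - i)) • e (i + 1) := by
  simp [Fop, e]

/-- A nonzero `E`-stable subspace of `V_N` contains `e_0`. -/
theorem e_zero_mem_of_Eop_stable {U : Submodule kk V} (hE : ∀ x ∈ U, Eop x ∈ U) (d : ℕ) :
    ∀ x ∈ U, x ≠ 0 → (∀ j, d < j → x j = 0) → e 0 ∈ U := by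
  induction d with
  | zero =>
    intro x hx hx0 hd
    have hxe : x = x 0 • e 0 := by
      ext j
      rcases j with _ | j
      · simp [e]
      · simp [e, hd (j + 1)]
    have h0 : x 0 ≠ 0 := fun h => hx0 (by rw [hxe, h, zero_smul])
    rw [hxe] at hx
    exact (U.smul_mem_iff h0).mp hx
  | succ d ih =>
    intro x hx hx0 hd
    by_cases h : x (d + 1) = 0
    · refine ih x hx hx0 fun j hj => ?_
      rcases (Nat.succ_le_of_lt hj).eq_or_lt with rfl | hj
      · exact h
      · exact hd j hj
    · refine ih (Eop x) (hE x hx) (fun h0 => ?_) fun j hj => ?_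
      · have hc := Eop_apply x d
        rw [h0, Finsupp.zero_apply] at hc
        exact mul_ne_zero (div_ne_zero (one_sub_qv_pow_ne_zero d.succ_ne_zero)
          (by simpa using one_sub_qv_pow_ne_zero one_ne_zero)) h hc.symm
      · rw [Eop_apply, hd (j + 1) (by omega), mul_zero]

/-- For `N > 0`, the module `W_N` is simple: any non-zero subspace `U ⊆ W_N` invariant
under `E`, `F` and `K` is all of `W_N`. -/
theorem WN_simple (N : ℤ) (hN : 0 < N) (U : Submodule kk V) (hUW : U ≤ W N)
    (hE : ∀ x ∈ U, Eop x ∈ U) (hF : ∀ x ∈ U, Fop N x ∈ U) (hK : ∀ x ∈ U, Kop N x ∈ U)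
    (hne : U ≠ ⊥) : U = W N := by
  refine le_antisymm hUW (Submodule.span_le.mpr ?_)
  rintro _ ⟨i, hi, rfl⟩
  rw [SetLike.mem_coe]
  induction i with
  | zero =>
    obtain ⟨x, hx, hx0⟩ := U.exists_mem_ne_zero_of_ne_bot hne
    refine e_zero_mem_of_Eop_stable hE (x.support.sup id) x hx hx0 fun j hj => ?_
    by_contra h
    exact hj.not_ge (Finset.le_sup (f := id) (Finsupp.mem_support_iff.mpr h))
  | succ i ih =>
    have h := hF _ (ih (by omega))
    rw [Fop_e] at h
    refine (U.smul_mem_iff (mul_ne_zero (pow_ne_zero _ v_ne_zero) ?_)).mp h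
    obtain ⟨n, hn⟩ := Int.eq_ofNat_of_zero_le (a := N - 1 - i) (by omega)
    rw [hn]
    exact qint_natCast_ne_zero (by omega)

end
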